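/- For all s, t ∈ μ_r, v ∈ A_1, and w ∈ A_r: z_s^δ(v y ⋄_s w(z − z_t^δ)) = −τ(τ(v) y ⋄_t τ(w)(z − z_s^δ))(z − z_t^δ). -/

import Mathlib

open FreeAlgebra

/-- Alphabet of `A_1 = ℚ⟨x,y⟩`. -/
inductive LetA : Type | x : LetA | y : LetA

/-- Alphabet of `A_r = ℚ⟨x, y_s : s ∈ μ_r⟩`; the group `G` plays the role of `μ_r`. -/
inductive LetR (G : Type) : Type | x : LetR G | y : G → LetR G

/-- `A_1 = ℚ⟨x, y⟩`. -/
abbrev A1 : Type := FreeAlgebra ℚ LetA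

/-- `A_r = ℚ⟨x, y_s : s ∈ μ_r⟩`. -/
abbrev Ar (G : Type) : Type := FreeAlgebra ℚ (LetR G)

noncomputable def X1 : A1 := ι ℚ LetA.x
noncomputable def Y1 : A1 := ι ℚ LetA.y

variable {G : Type} [CommGroup G]

noncomputable def Xr : Ar G := ι ℚ LetR.x
noncomputable def Yr (s : G) : Ar G := ι ℚ (LetR.y s)

/-- `z = x + y_1`. -/
noncomputable def zet : Ar G := Xr + Yr 1

open scoped Classical in
/-- `z_s^δ = x + δ(s) y_s` with `δ(1) = 0`, `δ(s) = 1` otherwise. -/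
noncomputable def zdel (s : G) : Ar G := if s = 1 then Xr else Xr + Yr s

/-- The involutive automorphism `φ` of `A_r`: `φ(x) = z`, `φ(y_s) = z_s^δ - z`. -/
noncomputable def phi : Ar G →ₐ[ℚ] Ar G :=
  lift ℚ (fun l => match l with
    | LetR.x => zet
    | LetR.y s => zdel s - zet)

/-- The natural embedding `A_1 → A_r`, `x ↦ x`, `y ↦ y_1`. -/
noncomputable def jm : A1 →ₐ[ℚ] Ar G :=
  lift ℚ (fun l => match l with
    | LetA.x => Xr
    | LetA.y => Yr 1)

open scoped Classical in
/-- The anti-automorphism `τ` of `A_r`: `τ(x) = y_1`, `τ(y_1) = x`, `τ(y_s) = -y_s` (`s ≠ 1`). -/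
noncomputable def tauR : Ar G →ₗ[ℚ] Ar G :=
  (MulOpposite.opLinearEquiv ℚ).symm.toLinearMap ∘ₗ
    (lift ℚ (fun l => match l with
      | LetR.x => MulOpposite.op (Yr 1)
      | LetR.y s => MulOpposite.op (if s = 1 then Xr else -(Yr s)) ) :
        Ar G →ₐ[ℚ] (Ar G)ᵐᵒᵖ).toLinearMap

/-- The anti-automorphism `τ` of `A_1`: `τ(x) = y`, `τ(y) = x`. -/
noncomputable def tau1 : A1 →ₗ[ℚ] A1 :=
  (MulOpposite.opLinearEquiv ℚ).symm.toLinearMap ∘ₗ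
    (lift ℚ (fun l => match l with
      | LetA.x => MulOpposite.op Y1
      | LetA.y => MulOpposite.op X1) : A1 →ₐ[ℚ] A1ᵐᵒᵖ).toLinearMap

/-- `wordP [(a₁,s₁),...,(a_l,s_l)] = x^{a₁} y_{s₁} ⋯ x^{a_l} y_{s_l}`,
i.e. the word `z_{a₁+1, s₁} ⋯ z_{a_l+1, s_l}`. -/
noncomputable def wordP (L : List (ℕ × G)) : Ar G :=
  (L.map (fun p => Xr ^ p.1 * Yr p.2)).prod

/-- Cumulative-product reindexing of subscripts: this realizes the composition `I ∘ M_s`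
on subscript lists, sending `(s₁, s₂, …, s_l)` to `(s s₁, s s₁ s₂, …, s s₁ ⋯ s_l)`. -/
def cumul : G → List (ℕ × G) → List (ℕ × G)
  | _, [] => []
  | g, p :: L => (p.1, g * p.2) :: cumul (g * p.2) L

/-- All the data entering the definition of the diamond products `⋄_s`:
the harmonic product `*`, the maps `ψ_s = φ ∘ I ∘ M_s`, and the family of
`ℚ`-bilinear diamond products `D s : A_1 × A_r → A_r` (together with the
corestriction `D1` of `⋄_1` to `A_1 × A_1 → A_1`), each characterized by its
defining recursive rules. -/
structure DiamondSetup (G : Type) [CommGroup G] where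
  /-- the harmonic product -/
  hst : Ar G →ₗ[ℚ] Ar G →ₗ[ℚ] Ar G
  one_hst : ∀ w, hst 1 w = w
  hst_one : ∀ v, hst v 1 = v
  hst_xr : ∀ v w, hst (v * Xr) w = hst v w * Xr
  hst_xl : ∀ v w, hst v (w * Xr) = hst v w * Xr
  hst_yy : ∀ (v w : Ar G) (s t : G), hst (v * Yr s) (w * Yr t) =
      hst v (w * Yr t) * Yr s + hst (v * Yr s) w * Yr t + hst v w * (Xr * Yr (s * t))
  /-- the linear automorphisms `ψ_s = φ ∘ I ∘ M_s` -/
  psi : G → (Ar G ≃ₗ[ℚ] Ar G)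
  psi_spec : ∀ (s : G) (L : List (ℕ × G)) (a : ℕ),
      psi s (wordP L * Xr ^ a) = phi (wordP (cumul s L) * Xr ^ a)
  /-- the diamond products `⋄_s : A_1 × A_r → A_r` -/
  D : G → A1 →ₗ[ℚ] Ar G →ₗ[ℚ] Ar G
  one_D : ∀ (s : G) (w : Ar G), D s 1 w = w
  D_one : ∀ (s : G) (v : A1), D s v 1 = psi s (phi (jm v))
  Dxx : ∀ (s : G) (v : A1) (w : Ar G), D s (v * X1) (w * Xr) =
      D s v (w * Xr) * Xr - D s (v * Y1) w * Xr
  Dyx : ∀ (s : G) (v : A1) (w : Ar G), D s (v * Y1) (w * Xr) =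
      D s v (w * Xr) * Yr 1 + D s (v * Y1) w * Xr
  Dxy : ∀ (s : G) (v : A1) (w : Ar G), D s (v * X1) (w * Yr 1) =
      D s v (w * Yr 1) * Xr + D s (v * X1) w * Yr 1
  Dyy : ∀ (s : G) (v : A1) (w : Ar G), D s (v * Y1) (w * Yr 1) =
      D s v (w * Yr 1) * Yr 1 - D s (v * X1) w * Yr 1
  Dxyt : ∀ (s t : G), t ≠ 1 → ∀ (v : A1) (w : Ar G), D s (v * X1) (w * Yr t) =
      D s v (w * Yr t) * Xr + D s v (w * (Xr + Yr t)) * Yr t - D s (v * Y1) w * Yr t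
  Dyyt : ∀ (s t : G), t ≠ 1 → ∀ (v : A1) (w : Ar G), D s (v * Y1) (w * Yr t) =
      D s v (w * Yr t) * Yr 1 - D s v (w * (Xr + Yr t)) * Yr t + D s (v * Y1) w * Yr t
  /-- `⋄_1` as a product `A_1 × A_1 → A_1` -/
  D1 : A1 →ₗ[ℚ] A1 →ₗ[ℚ] A1
  D1_spec : ∀ u v : A1, jm (D1 u v) = D 1 u (jm v)


section Helpers

/-- letters of `A_1`: `true ↦ y`, `false ↦ x`. -/
noncomputable def la (i : Bool) : A1 := if i then Y1 else X1

/-- letters of `A_r`: `true ↦ z - z_t^δ`, `false ↦ z_t^δ`. -/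
noncomputable def lb (i : Bool) (t : G) : Ar G := if i then zet - zdel t else zdel t

/-- sign -/
def sg (i : Bool) : ℚ := if i then -1 else 1

/-- match coefficient -/
def mtc (i j : Bool) : ℚ := if i = j then 1 else 0

theorem indA {A : Type} (P : FreeAlgebra ℚ A → Prop) (h1 : P 1)
    (hadd : ∀ a b, P a → P b → P (a + b)) (hsmul : ∀ (c : ℚ) a, P a → P (c • a))
    (hstep : ∀ a l, P a → P (a * ι ℚ l)) (v : FreeAlgebra ℚ A) : P v := by
  have key : ∀ v : FreeAlgebra ℚ A, ∀ a, P a → P (a * v) := by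
    intro v
    induction v using FreeAlgebra.induction with
    | grade0 r =>
      intro a ha
      rw [← Algebra.commutes, ← Algebra.smul_def]
      exact hsmul _ _ ha
    | grade1 l => intro a ha; exact hstep a l ha
    | mul p q hp hq => intro a ha; rw [← mul_assoc]; exact hq _ (hp _ ha)
    | add p q hp hq => intro a ha; rw [mul_add]; exact hadd _ _ (hp _ ha) (hq _ ha)
  simpa using key v 1 h1

theorem ind1 (P : A1 → Prop) (h1 : P 1)
    (hadd : ∀ a b, P a → P b → P (a + b)) (hsmul : ∀ (c : ℚ) a, P a → P (c • a))
    (hstep : ∀ a i, P a → P (a * la i)) (v : A1) : P v := by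
  refine indA P h1 hadd hsmul ?_ v
  intro a l ha
  cases l
  · exact hstep a false ha
  · exact hstep a true ha

theorem zdel_one : (zdel 1 : Ar G) = Xr := by simp [zdel]

theorem zdel_ne {t : G} (h : t ≠ 1) : zdel t = Xr + Yr t := by simp [zdel, h]

theorem lb_add (i : Bool) (t : G) : lb i t + lb (!i) t = zet := by
  cases i <;> simp [lb]

theorem indR (P : Ar G → Prop) (h1 : P 1)
    (hadd : ∀ a b, P a → P b → P (a + b)) (hsmul : ∀ (c : ℚ) a, P a → P (c • a))
    (hstep : ∀ a i t, P a → P (a * lb i t)) (v : Ar G) : P v := by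
  refine indA P h1 hadd hsmul ?_ v
  intro a l ha
  have hx : P (a * Xr) := by simpa [lb, zdel_one] using hstep a false 1 ha
  cases l with
  | x => exact hx
  | y t =>
    by_cases h : t = 1
    · subst h
      simpa [lb, zdel_one, zet, Yr] using hstep a true 1 ha
    · have h2 := hadd _ _ (hstep a false t ha) (hsmul (-1) _ hx)
      simpa [lb, zdel_ne h, mul_add, Yr] using h2

/-- `σ_s`: `x ↦ z_s^δ`, `y ↦ z - z_s^δ`. -/
noncomputable def sig (s : G) : A1 →ₐ[ℚ] Ar G :=
  lift ℚ (fun l => match l with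
    | LetA.x => zdel s
    | LetA.y => zet - zdel s)

theorem sig_la (s : G) (i : Bool) : sig s (la i) = lb i s := by
  cases i <;> simp [sig, la, lb, X1, Y1]

/-- words in `A_1` -/
noncomputable def w1 (L : List ℕ) : A1 := (L.map (fun n => X1 ^ n * Y1)).prod

theorem jm_X : (jm X1 : Ar G) = Xr := by simp [jm, X1]
theorem jm_Y : (jm Y1 : Ar G) = Yr 1 := by simp [jm, Y1]

theorem jm_w1 (L : List ℕ) : (jm (w1 L) : Ar G) = wordP (L.map (fun n => (n, 1))) := by
  induction L with
  | nil => simp [w1, wordP]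
  | cons n L ih =>
    simp only [w1, wordP, List.map_cons, List.prod_cons, map_mul, map_pow, jm_X, jm_Y] at ih ⊢
    rw [ih]

theorem cumul_one (s : G) (L : List ℕ) :
    cumul s (L.map (fun n => (n, (1 : G)))) = L.map (fun n => (n, s)) := by
  induction L with
  | nil => rfl
  | cons n L ih => simp [cumul, ih]

/-- `ρ_s`: `x ↦ z`, `y ↦ z_s^δ - z`. -/
noncomputable def rho (s : G) : A1 →ₐ[ℚ] Ar G :=
  lift ℚ (fun l => match l with
    | LetA.x => zet
    | LetA.y => zdel s - zet)

theorem rho_X (s : G) : rho s X1 = zet := by simp [rho, X1]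
theorem rho_Y (s : G) : rho s Y1 = zdel s - zet := by simp [rho, Y1]
theorem phi_X : phi (Xr : Ar G) = zet := by simp [phi, Xr]
theorem phi_Y (s : G) : phi (Yr s) = zdel s - zet := by simp [phi, Yr]

theorem phi_wordP (s : G) (L : List ℕ) :
    phi (wordP (L.map (fun n => (n, s)))) = rho s (w1 L) := by
  induction L with
  | nil => simp [w1, wordP]
  | cons n L ih =>
    simp only [w1, wordP, List.map_cons, List.prod_cons, map_mul, map_pow, rho_X, rho_Y,
      phi_X, phi_Y] at ih ⊢
    rw [ih]

theorem psi_jm (S : DiamondSetup G) (s : G) (q : A1) : S.psi s (jm q) = rho s q := by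
  have hspan : q ∈ Submodule.span ℚ {p : A1 | ∃ L a, p = w1 L * X1 ^ a} := by
    refine ind1 (fun q => q ∈ Submodule.span ℚ {p : A1 | ∃ L a, p = w1 L * X1 ^ a})
      ?_ ?_ ?_ ?_ q
    · exact Submodule.subset_span ⟨[], 0, by simp [w1]⟩
    · intro a b; exact Submodule.add_mem _
    · intro c a; exact Submodule.smul_mem _ c
    · intro a i ha
      induction ha using Submodule.span_induction with
      | mem p hp =>
        obtain ⟨L, a, rfl⟩ := hp
        refine Submodule.subset_span ?_
        cases i
        · exact ⟨L, a + 1, by simp [la, pow_succ, mul_assoc]⟩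
        · exact ⟨L ++ [a], 0, by simp [la, w1, mul_assoc]⟩
      | zero => simp
      | add p q _ _ hp hq => rw [add_mul]; exact Submodule.add_mem _ hp hq
      | smul c p _ hp => rw [smul_mul_assoc]; exact Submodule.smul_mem _ c hp
  induction hspan using Submodule.span_induction with
  | mem p hp =>
    obtain ⟨L, a, rfl⟩ := hp
    rw [map_mul jm, map_pow jm, jm_w1, jm_X, S.psi_spec, cumul_one, map_mul, map_mul,
      map_pow, map_pow, phi_wordP, phi_X, rho_X]
  | zero => simp
  | add p q _ _ hp hq => simp only [map_add, hp, hq]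
  | smul c p _ hp => simp only [map_smul, hp]

/-- `φ` on `A_1` -/
noncomputable def phi1 : A1 →ₐ[ℚ] A1 :=
  lift ℚ (fun l => match l with
    | LetA.x => X1 + Y1
    | LetA.y => - Y1)

theorem phi_jm (v : A1) : (phi (jm v) : Ar G) = jm (phi1 v) := by
  have : ((phi : Ar G →ₐ[ℚ] Ar G).comp jm) = (jm : A1 →ₐ[ℚ] Ar G).comp phi1 := by
    apply FreeAlgebra.hom_ext
    funext l
    cases l
    · simp [jm, phi1, phi_X, X1, Y1, zet]
    · simp [jm, phi1, phi_Y, X1, Y1, zet, zdel_one]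
  exact DFunLike.congr_fun this v

theorem D_one' (S : DiamondSetup G) (s : G) (v : A1) : S.D s v 1 = sig s v := by
  rw [S.D_one, phi_jm, psi_jm]
  have : (rho s : A1 →ₐ[ℚ] Ar G).comp phi1 = sig s := by
    apply FreeAlgebra.hom_ext
    funext l
    cases l
    · simp [phi1, sig, rho_X, rho_Y]
    · simp [phi1, sig, rho_Y]
  exact DFunLike.congr_fun this v

theorem Dzl (S : DiamondSetup G) (s : G) (v : A1) (w : Ar G) :
    S.D s (v * X1) w + S.D s (v * Y1) w = S.D s v w * zet := by
  refine indA (fun w => S.D s (v * X1) w + S.D s (v * Y1) w = S.D s v w * zet) ?_ ?_ ?_ ?_ w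
  · have hx := sig_la s false
    have hy := sig_la s true
    simp only [la, lb] at hx hy
    simp at hx hy
    simp [D_one', hx, hy, mul_sub]
  · intro a b ha hb
    simp only [map_add, add_mul, ← ha, ← hb]; abel
  · intro c a ha
    simp only [map_smul, smul_mul_assoc, ← ha, smul_add]
  · intro a l _
    cases l with
    | x =>
      have h1 := S.Dxx s v a
      have h2 := S.Dyx s v a
      simp only [Xr] at h1 h2
      rw [h1, h2, zet, Xr]; noncomm_ring
    | y t =>
      by_cases ht : t = 1
      · subst ht
        have h1 := S.Dxy s v a
        have h2 := S.Dyy s v a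
        simp only [Yr] at h1 h2
        rw [h1, h2, zet, Yr]; noncomm_ring
      · have h1 := S.Dxyt s t ht v a
        have h2 := S.Dyyt s t ht v a
        simp only [Yr] at h1 h2
        rw [h1, h2, zet, Yr]; noncomm_ring

theorem Dzr (S : DiamondSetup G) (s : G) (v : A1) : ∀ (w : Ar G),
    S.D s v (w * zet) = S.D s v w * zet := by
  refine ind1 (fun v => ∀ w, S.D s v (w * zet) = S.D s v w * zet) ?_ ?_ ?_ ?_ v
  · intro w; simp [S.one_D]
  · intro a b ha hb w
    simp only [map_add, LinearMap.add_apply, add_mul, ha, hb]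
  · intro c a ha w
    simp only [map_smul, LinearMap.smul_apply, smul_mul_assoc, ha]
  · intro a i ha w
    have hy : S.D s (a * Y1) (w * zet) = S.D s (a * Y1) w * zet := by
      have h1 : S.D s (a * Y1) (w * zet) =
          S.D s a (w * zet) * Yr 1 + S.D s (a * Y1) w * Xr
            - S.D s (a * X1) w * Yr 1 := by
        rw [zet, mul_add, map_add, S.Dyx, S.Dyy, map_add]; noncomm_ring
      have h2 := Dzl S s a w
      rw [h1, ha, ← h2]
      simp only [zet]
      noncomm_ring
    cases i
    · have h3 := Dzl S s a (w * zet)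
      have h4 := Dzl S s a w
      simp only [la, Bool.false_eq_true, if_false]
      rw [eq_sub_of_add_eq h3, eq_sub_of_add_eq h4, hy, ha]
      noncomm_ring
    · simpa [la] using hy

theorem Dxe (S : DiamondSetup G) (s t : G) (v : A1) (w : Ar G) :
    S.D s (v * X1) (w * zdel t) = (S.D s v (w * zdel t) - S.D s (v * Y1) w) * zdel t := by
  by_cases ht : t = 1
  · subst ht; rw [zdel_one, S.Dxx, sub_mul]
  · rw [zdel_ne ht, mul_add, map_add, S.Dxx, S.Dxyt s t ht, map_add, mul_add, map_add]
    noncomm_ring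

theorem Dye (S : DiamondSetup G) (s t : G) (v : A1) (w : Ar G) :
    S.D s (v * Y1) (w * zdel t) = S.D s v (w * zdel t) * (zet - zdel t)
      + S.D s (v * Y1) w * zdel t := by
  have h := Dzl S s v (w * zdel t)
  rw [eq_sub_of_add_eq' h, Dxe]
  noncomm_ring

/-- The auxiliary product `E_{s,t}`. -/
noncomputable def EE (S : DiamondSetup G) (s t : G) (v : A1) (w : Ar G) : Ar G :=
  S.D s (v * Y1) w - S.D s v (w * zdel t)

theorem EE_addl (S : DiamondSetup G) (s t : G) (v v' : A1) (w : Ar G) :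
    EE S s t (v + v') w = EE S s t v w + EE S s t v' w := by
  simp only [EE, add_mul, map_add, LinearMap.add_apply]; abel
theorem EE_addr (S : DiamondSetup G) (s t : G) (v : A1) (w w' : Ar G) :
    EE S s t v (w + w') = EE S s t v w + EE S s t v w' := by
  simp only [EE, add_mul, map_add]; abel
theorem EE_smull (S : DiamondSetup G) (s t : G) (c : ℚ) (v : A1) (w : Ar G) :
    EE S s t (c • v) w = c • EE S s t v w := by
  simp only [EE, smul_mul_assoc, map_smul, LinearMap.smul_apply, smul_sub]
theorem EE_smulr (S : DiamondSetup G) (s t : G) (c : ℚ) (v : A1) (w : Ar G) :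
    EE S s t v (c • w) = c • EE S s t v w := by
  simp only [EE, smul_mul_assoc, map_smul, smul_sub]

theorem EE_alt (S : DiamondSetup G) (s t : G) (v : A1) (w : Ar G) :
    EE S s t v w = S.D s v (w * (zet - zdel t)) - S.D s (v * X1) w := by
  rw [EE, mul_sub, map_sub, Dzr, ← Dzl]; abel

theorem D_xe (S : DiamondSetup G) (s t : G) (v : A1) (w : Ar G) :
    S.D s (v * X1) (w * zdel t) = - EE S s t v w * zdel t := by
  rw [Dxe, EE]; noncomm_ring

theorem D_ye (S : DiamondSetup G) (s t : G) (v : A1) (w : Ar G) :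
    S.D s (v * Y1) (w * zdel t) = S.D s (v * Y1) w * zet - EE S s t v w * (zet - zdel t) := by
  rw [Dye, EE]; noncomm_ring

theorem D_yu (S : DiamondSetup G) (s t : G) (v : A1) (w : Ar G) :
    S.D s (v * Y1) (w * (zet - zdel t)) = EE S s t v w * (zet - zdel t) := by
  rw [mul_sub, map_sub, Dzr, D_ye]; noncomm_ring

theorem D_xu (S : DiamondSetup G) (s t : G) (v : A1) (w : Ar G) :
    S.D s (v * X1) (w * (zet - zdel t)) = S.D s (v * X1) w * zet + EE S s t v w * zdel t := by
  rw [mul_sub, map_sub, Dzr, D_xe]; noncomm_ring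

theorem R_rule (S : DiamondSetup G) (s t a : G) (i j : Bool) (v : A1) (w : Ar G) :
    EE S s t (v * la i) (w * lb j a) = EE S s t v (w * lb j a) * lb i t
      + EE S s a (v * la i) w * lb j a - mtc i j • (EE S s a v w * lb j a * zet) := by
  cases i <;> cases j <;> simp only [la, lb, mtc, if_true, if_false, Bool.false_eq_true,
    reduceCtorEq, one_smul, zero_smul, sub_zero]
  · -- x e
    have h : S.D s (v * X1 * Y1) w = EE S s a (v * X1) w + S.D s (v * X1) (w * zdel a) := by
      rw [EE]; abel
    rw [EE, D_xe S s t, D_ye, h, D_xe]; noncomm_ring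
  · -- x u
    rw [EE, D_xe S s t, D_yu]; noncomm_ring
  · -- y e
    have h : S.D s (v * Y1 * X1) (w * zdel a) = - EE S s a (v * Y1) w * zdel a := D_xe ..
    rw [EE_alt, D_yu, h]; noncomm_ring
  · -- y u
    have h : S.D s (v * Y1 * X1) w =
        S.D s (v * Y1) (w * (zet - zdel a)) - EE S s a (v * Y1) w := by
      rw [EE_alt]; abel
    rw [EE_alt, D_yu, D_xu, h, D_yu]; noncomm_ring

theorem R_v (S : DiamondSetup G) (s t : G) (i : Bool) (v : A1) :
    EE S s t (v * la i) 1 = EE S s t v 1 * lb i t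
      + sg i • (sig s v * lb i s * lb (!i) s) := by
  have hx := sig_la s false
  have hy := sig_la s true
  simp only [la, lb, if_true, Bool.false_eq_true, if_false] at hx hy
  cases i <;> simp only [la, lb, sg, if_true, if_false, Bool.false_eq_true, Bool.not_true,
    Bool.not_false, one_smul, neg_smul]
  · have h := D_xe S s t v 1
    rw [EE, h, D_one', map_mul, map_mul, hx, hy]; noncomm_ring
  · have h := D_yu S s t v 1
    rw [EE_alt, h, D_one', map_mul, map_mul, hx, hy]; noncomm_ring

theorem R_w (S : DiamondSetup G) (s t a : G) (j : Bool) (w : Ar G) :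
    EE S s t 1 (w * lb j a) = EE S s a 1 w * lb j a
      + sg j • (w * lb j a * lb (!j) t) := by
  cases j <;> simp only [lb, sg, if_true, if_false, Bool.false_eq_true, Bool.not_true,
    Bool.not_false, one_smul, neg_smul]
  · rw [EE, Dye, EE, S.one_D, S.one_D]; noncomm_ring
  · rw [EE, D_yu, S.one_D]; noncomm_ring

theorem E_11 (S : DiamondSetup G) (s t : G) : EE S s t 1 1 = zet - zdel s - zdel t := by
  have hy := sig_la s true
  simp only [la, lb, if_true] at hy
  rw [EE, D_one', S.one_D, map_mul, map_one, hy]; simp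

theorem L_v (S : DiamondSetup G) (s t : G) (i : Bool) (v : A1) :
    EE S s t (la i * v) 1 = lb i s * EE S s t v 1
      + sg i • (lb (!i) t * lb i t * sig t v) := by
  refine ind1 (fun v => EE S s t (la i * v) 1 = lb i s * EE S s t v 1
      + sg i • (lb (!i) t * lb i t * sig t v)) ?_ ?_ ?_ ?_ v
  · have h := R_v S s t i 1
    rw [one_mul] at h
    rw [mul_one, h, E_11, map_one, map_one]
    cases i <;> simp only [lb, sg, if_true, if_false, Bool.false_eq_true, Bool.not_true,
      Bool.not_false, one_smul, neg_smul] <;> noncomm_ring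
  · intro a b ha hb
    simp only [mul_add, EE_addl, ha, hb, map_add]; module
  · intro c a ha
    simp only [mul_smul_comm, EE_smull, ha, map_smul]; module
  · intro a k ha
    rw [← mul_assoc, R_v, ha, R_v, map_mul, map_mul, sig_la, sig_la]
    simp only [mul_add, add_mul, smul_mul_assoc, mul_smul_comm, mul_assoc]; module

theorem L_w (S : DiamondSetup G) (s t a : G) (j : Bool) (w : Ar G) :
    EE S s t 1 (lb j a * w) = lb j a * EE S a t 1 w
      + sg j • (lb (!j) s * lb j a * w) := by
  revert t
  refine indR (fun w => ∀ t, EE S s t 1 (lb j a * w) = lb j a * EE S a t 1 w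
      + sg j • (lb (!j) s * lb j a * w)) ?_ ?_ ?_ ?_ w
  · intro t
    have h := R_w S s t a j 1
    rw [one_mul] at h
    rw [mul_one, h, E_11, E_11]
    cases j <;> simp only [lb, sg, if_true, if_false, Bool.false_eq_true, Bool.not_true,
      Bool.not_false, one_smul, neg_smul] <;> noncomm_ring
  · intro a b ha hb t
    simp only [mul_add, EE_addr, ha, hb]; module
  · intro c a ha t
    simp only [mul_smul_comm, EE_smulr, ha]; module
  · intro x k b hx t
    rw [← mul_assoc, R_w, hx, R_w]
    simp only [mul_add, add_mul, smul_mul_assoc, mul_smul_comm, mul_assoc]; module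

theorem L_rule (S : DiamondSetup G) (i j : Bool) (v : A1) : ∀ (w : Ar G) (s t a : G),
    EE S s t (la i * v) (lb j a * w) = lb i s * EE S s t v (lb j a * w)
      + lb j a * EE S a t (la i * v) w - mtc i j • (zet * lb j a * EE S a t v w) := by
  refine ind1 (fun v => ∀ (w : Ar G) (s t a : G),
    EE S s t (la i * v) (lb j a * w) = lb i s * EE S s t v (lb j a * w)
      + lb j a * EE S a t (la i * v) w - mtc i j • (zet * lb j a * EE S a t v w)) ?_ ?_ ?_ ?_ v
  · intro w
    refine indR (fun w => ∀ (s t a : G),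
      EE S s t (la i * 1) (lb j a * w) = lb i s * EE S s t 1 (lb j a * w)
      + lb j a * EE S a t (la i * 1) w - mtc i j • (zet * lb j a * EE S a t 1 w)) ?_ ?_ ?_ ?_ w
    · intro s t a
      have h1 := R_rule S s t a i j 1 1
      have h2 := fun s t => R_v S s t i 1
      have h3 := fun s t => R_w S s t a j 1
      simp only [one_mul] at h1 h2 h3
      simp only [mul_one, h1, h2, h3, E_11, map_one, one_mul]
      cases i <;> cases j <;> simp only [lb, sg, mtc, if_true, if_false, Bool.false_eq_true,
        Bool.not_true, reduceCtorEq,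
        Bool.not_false, one_smul, neg_smul, zero_smul] <;> noncomm_ring
    · intro a b ha hb s t c
      simp only [mul_add, EE_addr, ha, hb]; module
    · intro c a ha s t b
      simp only [mul_smul_comm, EE_smulr, ha]; module
    · intro x k b hx s t a
      have h1 := R_rule S s t b i k 1 (lb j a * x)
      have h2 := R_rule S a t b i k 1 x
      simp only [mul_one] at hx
      simp only [one_mul] at h1 h2
      rw [mul_one, ← mul_assoc, h1, hx, h2]
      simp only [R_w]
      simp only [L_w]
      cases i <;> cases j <;> cases k <;> simp only [lb, sg, mtc, if_true, if_false,
        Bool.false_eq_true, Bool.not_true, reduceCtorEq,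
        Bool.not_false, one_smul, neg_smul, zero_smul] <;> noncomm_ring
  · intro a b ha hb w s t c
    simp only [mul_add, EE_addl, ha, hb]; module
  · intro c a ha w s t b
    simp only [mul_smul_comm, EE_smull, ha]; module
  · intro x k hv w
    refine indR (fun w => ∀ (s t a : G),
      EE S s t (la i * (x * la k)) (lb j a * w) = lb i s * EE S s t (x * la k) (lb j a * w)
      + lb j a * EE S a t (la i * (x * la k)) w
      - mtc i j • (zet * lb j a * EE S a t (x * la k) w)) ?_ ?_ ?_ ?_ w
    · intro s t a
      have h1 := R_rule S s t a k j (la i * x) 1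
      have h2 := R_rule S s t a k j x 1
      have h3 := hv 1 s t a
      simp only [mul_one, one_mul] at h1 h2 h3 ⊢
      simp only [← mul_assoc (la i)]
      rw [h1, h2, h3]
      simp only [R_v]
      simp only [L_v, map_mul, sig_la]
      cases i <;> cases j <;> cases k <;> simp only [lb, sg, mtc, if_true, if_false,
        Bool.false_eq_true, Bool.not_true, reduceCtorEq,
        Bool.not_false, one_smul, neg_smul, zero_smul] <;> noncomm_ring
    · intro a b ha hb s t c
      simp only [mul_add, EE_addr, ha, hb]; module
    · intro c a ha s t b
      simp only [mul_smul_comm, EE_smulr, ha]; module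
    · intro y l b hy s t a
      simp only [← mul_assoc (la i), ← mul_assoc (lb j a)] at hy ⊢
      have hv' := hv (y * lb l b) s t a
      simp only [← mul_assoc (lb j a)] at hv'
      rw [R_rule S s t b k l, hv', hy, hv, R_rule S s t b k l, R_rule S a t b k l,
        R_rule S a t b k l]
      simp only [mul_add, add_mul, mul_sub, sub_mul, smul_mul_assoc, mul_smul_comm, mul_assoc]
      module

theorem tauR_mul (a b : Ar G) : tauR (a * b) = tauR b * tauR a := by
  simp [tauR]
theorem tau1_mul (a b : A1) : tau1 (a * b) = tau1 b * tau1 a := by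
  simp [tau1]
theorem tauR_one : tauR (1 : Ar G) = 1 := by simp [tauR]
theorem tau1_one : tau1 (1 : A1) = 1 := by simp [tau1]
theorem tau1_la (i : Bool) : tau1 (la i) = la (!i) := by
  cases i <;> simp [tau1, la, X1, Y1]
theorem tauR_lb (i : Bool) (t : G) : tauR (lb i t) = lb (!i) t := by
  have hx : tauR (Xr : Ar G) = Yr 1 := by simp [tauR, Xr]
  have hy : tauR (Yr 1 : Ar G) = Xr := by simp [tauR, Yr]
  by_cases h : t = 1
  · subst h
    cases i <;> simp [lb, zdel_one, zet, hx, hy]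
  · have hyt : tauR (Yr t : Ar G) = - Yr t := by simp [tauR, Yr, h]
    cases i <;> simp [lb, zdel_ne h, zet, hx, hy, hyt] <;> abel
theorem tauR_zet : tauR (zet : Ar G) = zet := by
  rw [← lb_add true 1, map_add, tauR_lb, tauR_lb]; simp [add_comm]
theorem tauR_tauR (w : Ar G) : tauR (tauR w) = w := by
  refine indR (fun w => tauR (tauR w) = w) ?_ ?_ ?_ ?_ w
  · simp [tauR_one]
  · intro a b ha hb; simp [ha, hb]
  · intro c a ha; simp [ha]
  · intro a i t ha; simp [tauR_mul, tauR_lb, ha]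
theorem tau_sig (s : G) (v : A1) : tauR (sig s (tau1 v)) = sig s v := by
  refine ind1 (fun v => tauR (sig s (tau1 v)) = sig s v) ?_ ?_ ?_ ?_ v
  · simp [tauR_one, tau1_one]
  · intro a b ha hb; simp [ha, hb]
  · intro c a ha; simp [ha]
  · intro a i ha; simp [tauR_mul, tau1_mul, tau1_la, sig_la, tauR_lb, ha]

theorem sg_not (i : Bool) : sg (!i) = - sg i := by cases i <;> simp [sg]
theorem mt_not (i j : Bool) : mtc (!i) (!j) = mtc i j := by cases i <;> cases j <;> simp [mtc]

theorem E_sym (S : DiamondSetup G) (v : A1) : ∀ (w : Ar G) (s t : G),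
    EE S s t v w = - tauR (EE S t s (tau1 v) (tauR w)) := by
  refine ind1 (fun v => ∀ (w : Ar G) (s t : G),
    EE S s t v w = - tauR (EE S t s (tau1 v) (tauR w))) ?_ ?_ ?_ ?_ v
  · intro w
    refine indR (fun w => ∀ (s t : G),
      EE S s t 1 w = - tauR (EE S t s (tau1 1) (tauR w))) ?_ ?_ ?_ ?_ w
    · intro s t
      have h : ∀ t : G, tauR (zdel t) = zet - zdel t := fun t => tauR_lb false t
      rw [tauR_one, tau1_one, E_11, E_11]
      simp only [map_sub, tauR_zet, h]; abel
    · intro a b ha hb s t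
      simp only [EE_addr, map_add, ha, hb]; abel
    · intro c a ha s t
      simp only [EE_smulr, map_smul, ha, smul_neg]
    · intro x j a hx s t
      rw [R_w, hx, tau1_one, tauR_mul, tauR_lb, L_w]
      simp only [map_add, map_smul, tauR_mul, tauR_lb, tauR_tauR, sg_not, Bool.not_not,
        mul_assoc, neg_mul]
      module
  · intro a b ha hb w s t
    simp only [EE_addl, map_add, ha, hb]; abel
  · intro c a ha w s t
    simp only [EE_smull, map_smul, ha, smul_neg]
  · intro x i hv w
    refine indR (fun w => ∀ (s t : G),
      EE S s t (x * la i) w = - tauR (EE S t s (tau1 (x * la i)) (tauR w))) ?_ ?_ ?_ ?_ w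
    · intro s t
      rw [R_v, hv, tauR_one, tau1_mul, tau1_la, L_v]
      simp only [map_add, map_smul, tauR_mul, tauR_lb, tau_sig, sg_not, Bool.not_not,
        mul_assoc, neg_mul]
      module
    · intro a b ha hb s t
      simp only [EE_addr, map_add, ha, hb]; abel
    · intro c a ha s t
      simp only [EE_smulr, map_smul, ha, smul_neg]
    · intro y j a hy s t
      rw [R_rule, hv, hy, hv]
      simp only [tau1_mul, tau1_la, tauR_mul, tauR_lb]
      rw [L_rule]
      simp only [map_add, map_sub, map_smul, tauR_mul, tauR_lb, tauR_zet, mt_not, Bool.not_not,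
        mul_assoc, neg_mul]
      module

end Helpers

/-- For all `s, t ∈ μ_r`, `v ∈ A_1`, `w ∈ A_r`:
`z_s^δ (v y ⋄_s w(z − z_t^δ)) = −τ(τ(v) y ⋄_t τ(w)(z − z_s^δ))(z − z_t^δ)`. -/
theorem statement8 {G : Type} [CommGroup G] (S : DiamondSetup G)
    (s t : G) (v : A1) (w : Ar G) :
    zdel s * S.D s (v * Y1) (w * (zet - zdel t)) =
      -(tauR (S.D t (tau1 v * Y1) (tauR w * (zet - zdel s)))) * (zet - zdel t) := by
  have h : tauR (zet - zdel s) = zdel s := tauR_lb true s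
  rw [D_yu, D_yu, tauR_mul, E_sym, h]
  noncomm_ring
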